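/- For all Borel probability measures μ, μ' on ℝ^d with finite first moments and all nonnegative weights λ = (λ₁,…,λ_d), the marginally-penalized Wasserstein distance admits the dual representation D(μ,μ') = sup_{φ ∈ F_λ} { ∫ φ dμ − ∫ φ dμ' }. -/

import Mathlib

open MeasureTheory Set
open scoped ENNReal

/-- The 1-Wasserstein distance between two measures, defined via the primal
(optimal transport) formulation: the infimum of `∫ ‖x - y‖ dπ` over all
couplings `π` of `μ` and `ν`. -/
noncomputable def W1 {E : Type*} [MeasurableSpace E] [NormedAddCommGroup E]
    (μ ν : Measure E) : ℝ :=
  sInf {c : ℝ | ∃ π : Measure (E × E), IsProbabilityMeasure π ∧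
    π.map Prod.fst = μ ∧ π.map Prod.snd = ν ∧ c = ∫ p, ‖p.1 - p.2‖ ∂π}

/-- A measure has a finite first moment. -/
def FiniteFirstMoment {E : Type*} [MeasurableSpace E] [NormedAddCommGroup E]
    (μ : Measure E) : Prop :=
  HasFiniteIntegral (fun x => ‖x‖) μ

/-- The marginally-penalized Wasserstein (MPW) distance with weights `lam`. -/
noncomputable def MPW {d : ℕ} (lam : Fin d → ℝ)
    (μ ν : Measure (EuclideanSpace ℝ (Fin d))) : ℝ :=
  W1 μ ν + ∑ j : Fin d, lam j * W1 (μ.map (fun x => x j)) (ν.map (fun x => x j))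

/-- The function class `F_λ`: functions of the form `f + ∑ j, λ j * (f_j ∘ p_j)`
with `f` 1-Lipschitz on `ℝ^d` and each `f_j` 1-Lipschitz on `ℝ`. -/
def Flam {d : ℕ} (lam : Fin d → ℝ) : Set (EuclideanSpace ℝ (Fin d) → ℝ) :=
  {φ | ∃ (f : EuclideanSpace ℝ (Fin d) → ℝ) (g : Fin d → ℝ → ℝ),
    LipschitzWith 1 f ∧ (∀ j, LipschitzWith 1 (g j)) ∧
    ∀ x, φ x = f x + ∑ j : Fin d, lam j * g j (x j)}

open ProbabilityTheory

/-- A bound on `∑ i, F (a i) * (p i - q i)` over 1-Lipschitz functions `F` scales linearly with the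
Lipschitz constant, including the constant `0`. -/
lemma sum_lipschitz_le {X ι : Type*} [PseudoMetricSpace X] [Fintype ι] {a : ι → X} {p q : ι → ℝ}
    (hp : ∑ i, p i = 1) (hq : ∑ i, q i = 1) {C : ℝ}
    (h : ∀ F : X → ℝ, LipschitzWith 1 F → ∑ i, F (a i) * p i - ∑ i, F (a i) * q i ≤ C)
    {L : ℝ} (hL : 0 ≤ L) {F : X → ℝ} (hF : ∀ x y, F x ≤ F y + L * dist x y) :
    ∑ i, F (a i) * p i - ∑ i, F (a i) * q i ≤ L * C := by
  rcases hL.eq_or_lt with rfl | hL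
  · have hconst : ∀ x y, F x = F y := fun x y =>
      le_antisymm (by simpa using hF x y) (by simpa using hF y x)
    rcases isEmpty_or_nonempty ι with hι | ⟨⟨i₀⟩⟩
    · simp at hp
    · simp [hconst _ (a i₀), ← Finset.mul_sum, hp, hq]
  · have hlip : LipschitzWith 1 fun x => L⁻¹ * F x := by
      refine LipschitzWith.of_le_add fun x y => ?_
      have := mul_le_mul_of_nonneg_left (hF x y) (inv_pos.2 hL).le
      rwa [mul_add, inv_mul_cancel_left₀ hL.ne'] at this
    have := h _ hlip
    simp only [mul_assoc, ← Finset.mul_sum, ← mul_sub] at this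
    rwa [inv_mul_le_iff₀ hL] at this

/-- The linear map sending a transport matrix to its row sums, column sums and cost. -/
noncomputable def marginalsCost {ι : Type*} [Fintype ι] (c : ι × ι → ℝ) :
    (ι × ι → ℝ) →ₗ[ℝ] (ι → ℝ) × (ι → ℝ) × ℝ where
  toFun w := (fun i => ∑ j, w (i, j), fun j => ∑ i, w (i, j), ∑ ij, w ij * c ij)
  map_add' w w' := by
    ext <;> simp [Finset.sum_add_distrib, add_mul]
  map_smul' r w := by
    ext <;> simp [Finset.mul_sum, mul_assoc]

lemma strongDual_marginals_apply {ι : Type*} [Fintype ι] [DecidableEq ι]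
    (f : StrongDual ℝ ((ι → ℝ) × (ι → ℝ) × ℝ)) (p q : ι → ℝ) (c : ℝ) :
    f (p, q, c) = ∑ i, p i * f (Pi.single i 1, 0, 0) + ∑ i, q i * f (0, Pi.single i 1, 0)
      + c * f (0, 0, 1) := by
  have hsplit : (p, q, c) = (∑ i, p i • ((Pi.single i 1, 0, 0) : (ι → ℝ) × (ι → ℝ) × ℝ))
      + (∑ i, q i • ((0, Pi.single i 1, 0) : (ι → ℝ) × (ι → ℝ) × ℝ))
      + c • ((0, 0, 1) : (ι → ℝ) × (ι → ℝ) × ℝ) := by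
    ext i <;> simp [Prod.fst_sum, Prod.snd_sum, Finset.sum_apply, Pi.single_apply]
  rw [hsplit]
  simp only [map_add, map_sum, map_smul, smul_eq_mul]

/-- Kantorovich–Rubinstein duality for finitely supported measures. -/
lemma exists_transport_matrix {X ι : Type*} [PseudoMetricSpace X] [Fintype ι] {a : ι → X}
    {p q : ι → ℝ} (hp : p ∈ stdSimplex ℝ ι) (hq : q ∈ stdSimplex ℝ ι) {C : ℝ}
    (h : ∀ F : X → ℝ, LipschitzWith 1 F → ∑ i, F (a i) * p i - ∑ i, F (a i) * q i ≤ C) :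
    ∃ w : ι → ι → ℝ, (∀ i j, 0 ≤ w i j) ∧ (∀ i, ∑ j, w i j = p i) ∧ (∀ j, ∑ i, w i j = q j) ∧
      ∑ i, ∑ j, w i j * dist (a i) (a j) ≤ C := by
  classical
  set c : ι × ι → ℝ := fun ij => dist (a ij.1) (a ij.2) with hc
  set K := marginalsCost c '' stdSimplex ℝ (ι × ι)
  set T : Set ((ι → ℝ) × (ι → ℝ) × ℝ) := {p} ×ˢ {q} ×ˢ Iic C
  by_cases hKT : Disjoint K T
  · exfalso
    have hK₁ : Convex ℝ K := (convex_stdSimplex ℝ _).linear_image _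
    have hK₂ : IsCompact K := (isCompact_stdSimplex ℝ _).image
      (LinearMap.continuous_of_finiteDimensional _)
    have hT₁ : Convex ℝ T := (convex_singleton p).prod ((convex_singleton q).prod (convex_Iic C))
    have hT₂ : IsClosed T := isClosed_singleton.prod (isClosed_singleton.prod isClosed_Iic)
    obtain ⟨f, s, t, hs, hst, ht⟩ := geometric_hahn_banach_compact_closed hK₁ hK₂ hT₁ hT₂ hKT
    set u : ι → ℝ := fun i => f (Pi.single i 1, 0, 0)
    set v : ι → ℝ := fun i => f (0, Pi.single i 1, 0)
    set L : ℝ := - f (0, 0, 1) with hLdef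
    have hf : ∀ p q c, f (p, q, c) = ∑ i, p i * u i + ∑ i, q i * v i - c * L := by
      intro p q c
      rw [strongDual_marginals_apply, hLdef]
      ring
    have huv : ∀ i j, u i + v j ≤ s + L * dist (a i) (a j) := by
      intro i j
      have hmem : marginalsCost c (Pi.single (i, j) 1) ∈ K :=
        ⟨_, single_mem_stdSimplex ℝ _, rfl⟩
      have hval : marginalsCost c (Pi.single (i, j) 1)
          = (Pi.single i 1, Pi.single j 1, dist (a i) (a j)) := by
        ext k
        · by_cases hk : k = i <;> simp [marginalsCost, Pi.single_apply, Prod.mk.injEq, hk, ite_and]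
        · by_cases hk : k = j <;> simp [marginalsCost, Pi.single_apply, Prod.mk.injEq, hk, ite_and]
        · simp [marginalsCost, Pi.single_apply, hc]
      have := hs _ hmem
      rw [hval, hf] at this
      simp [Pi.single_apply] at this
      linarith
    have htc : ∀ c ≤ C, t < ∑ i, p i * u i + ∑ i, q i * v i - c * L := by
      intro c hc
      rw [← hf]
      exact ht _ ⟨rfl, rfl, hc⟩
    have hL : 0 ≤ L := by
      by_contra! hneg
      set m := ∑ i, p i * u i + ∑ i, q i * v i
      have h₁ := htc (min C ((m - t) / L)) (min_le_left _ _)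
      have h₂ := mul_le_mul_of_nonpos_right (min_le_right C ((m - t) / L)) hneg.le
      rw [div_mul_cancel₀ _ hneg.ne] at h₂
      linarith
    have hι : Nonempty ι := by
      by_contra hι
      rw [not_nonempty_iff] at hι
      simpa using hp.2
    set F : X → ℝ := fun x =>
      Finset.univ.inf' Finset.univ_nonempty fun j => s - v j + L * dist x (a j)
    have hFlip : ∀ x y, F x ≤ F y + L * dist x y := by
      intro x y
      rw [← sub_le_iff_le_add]
      refine Finset.le_inf' _ _ fun j _ => ?_
      have h₁ : F x ≤ s - v j + L * dist x (a j) :=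
        Finset.inf'_le (fun j => s - v j + L * dist x (a j)) (Finset.mem_univ j)
      have h₂ := mul_le_mul_of_nonneg_left (dist_triangle x y (a j)) hL
      linarith
    have hFu : ∀ i, u i ≤ F (a i) := fun i =>
      Finset.le_inf' _ _ fun j _ => by linarith [huv i j]
    have hFv : ∀ i, F (a i) ≤ s - v i := by
      intro i
      have := Finset.inf'_le (fun j => s - v j + L * dist (a i) (a j)) (Finset.mem_univ i)
      simpa using this
    have hFle := sum_lipschitz_le hp.2 hq.2 h hL hFlip
    have h₁ : ∑ i, p i * u i ≤ ∑ i, F (a i) * p i := Finset.sum_le_sum fun i _ => by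
      rw [mul_comm]; exact mul_le_mul_of_nonneg_right (hFu i) (hp.1 i)
    have h₂ : ∑ i, F (a i) * q i ≤ s - ∑ i, q i * v i := by
      calc ∑ i, F (a i) * q i ≤ ∑ i, (s - v i) * q i := Finset.sum_le_sum fun i _ =>
            mul_le_mul_of_nonneg_right (hFv i) (hq.1 i)
        _ = s - ∑ i, q i * v i := by
          simp [sub_mul, Finset.sum_sub_distrib, ← Finset.mul_sum, hq.2, mul_comm (v _)]
    have h₃ := htc C le_rfl
    linarith [mul_comm L C]
  · obtain ⟨_, ⟨w, hw, rfl⟩, hwp, hwq, hwC⟩ := Set.not_disjoint_iff.1 hKT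
    refine ⟨fun i j => w (i, j), fun i j => hw.1 _, fun i => congrFun hwp i,
      fun j => congrFun hwq j, ?_⟩
    rw [← Fintype.sum_prod_type' (f := fun i j => w (i, j) * dist (a i) (a j))]
    exact hwC

section Coupling

variable {E ι : Type*} [MeasurableSpace E] {μ ν : Measure E} {τ : E → ι} {w : ι → ι → ℝ}

lemma integral_comp_fst {π : Measure (E × E)} (hπ : π.map Prod.fst = μ) {f : E → ℝ}
    (hf : Integrable f μ) :
    Integrable (fun p => f p.1) π ∧ ∫ p, f p.1 ∂π = ∫ x, f x ∂μ := by
  subst hπ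
  exact ⟨hf.comp_measurable measurable_fst, (integral_map measurable_fst.aemeasurable hf.1).symm⟩

lemma integral_comp_snd {π : Measure (E × E)} (hπ : π.map Prod.snd = ν) {f : E → ℝ}
    (hf : Integrable f ν) :
    Integrable (fun p => f p.2) π ∧ ∫ p, f p.2 ∂π = ∫ x, f x ∂ν := by
  subst hπ
  exact ⟨hf.comp_measurable measurable_snd, (integral_map measurable_snd.aemeasurable hf.1).symm⟩

variable [Fintype ι]

/-- The measure on `E × E` obtained by spreading the mass `w i j` over the product of the fibres of
`τ` over `i` and `j`, conditionally on `μ` and `ν`. -/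
noncomputable def glue (μ ν : Measure E) (τ : E → ι) (w : ι → ι → ℝ) : Measure (E × E) :=
  ∑ i, ∑ j, ENNReal.ofReal (w i j) • (cond μ (τ ⁻¹' {i})).prod (cond ν (τ ⁻¹' {j}))

lemma isProbabilityMeasure_cond_of_ne_zero [IsFiniteMeasure μ] (hw : ∀ i j, 0 ≤ w i j)
    (hrow : ∀ i, ∑ j, w i j = μ.real (τ ⁻¹' {i})) {i j : ι} (hij : w i j ≠ 0) :
    IsProbabilityMeasure (cond μ (τ ⁻¹' {i})) := by
  refine cond_isProbabilityMeasure fun h => hij ?_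
  have h₁ := hrow i
  rw [measureReal_def, h, ENNReal.toReal_zero,
    Finset.sum_eq_zero_iff_of_nonneg fun j _ => hw i j] at h₁
  exact h₁ j (Finset.mem_univ j)

lemma glue_map_swap [IsFiniteMeasure μ] [IsFiniteMeasure ν] :
    (glue μ ν τ w).map Prod.swap = glue ν μ τ fun j i => w i j := by
  simp only [glue, Measure.map_finset_sum' measurable_swap.aemeasurable, Measure.map_smul,
    Measure.prod_swap]
  exact Finset.sum_comm

variable [MeasurableSpace ι] [DiscreteMeasurableSpace ι]

lemma integral_comp_finite (ρ : Measure E) [IsProbabilityMeasure ρ] (hτ : Measurable τ)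
    (H : ι → ℝ) :
    ∫ x, H (τ x) ∂ρ = ∑ i, H i * ρ.real (τ ⁻¹' {i}) := by
  have := Measure.isProbabilityMeasure_map (μ := ρ) hτ.aemeasurable
  rw [← integral_map (φ := τ) hτ.aemeasurable (measurable_of_finite H).aestronglyMeasurable,
    integral_fintype .of_finite]
  simp [map_measureReal_apply hτ, mul_comm]

lemma sum_measureReal_fiber (ρ : Measure E) [IsProbabilityMeasure ρ] (hτ : Measurable τ) :
    (fun i => ρ.real (τ ⁻¹' {i})) ∈ stdSimplex ℝ ι := by
  refine ⟨fun i => measureReal_nonneg, ?_⟩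
  simpa using (integral_comp_finite ρ hτ fun _ => 1).symm

lemma glue_map_fst [IsFiniteMeasure μ] [IsFiniteMeasure ν] (hτ : Measurable τ)
    (hw : ∀ i j, 0 ≤ w i j) (hrow : ∀ i, ∑ j, w i j = μ.real (τ ⁻¹' {i}))
    (hcol : ∀ j, ∑ i, w i j = ν.real (τ ⁻¹' {j})) :
    (glue μ ν τ w).map Prod.fst = μ := by
  simp only [glue, Measure.map_finset_sum' measurable_fst.aemeasurable, Measure.map_smul,
    Measure.map_fst_prod]
  conv_rhs => rw [← sum_meas_smul_cond_fiber hτ μ]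
  refine Finset.sum_congr rfl fun i _ => ?_
  have hterm : ∀ j, ENNReal.ofReal (w i j) •
      (cond ν (τ ⁻¹' {j}) univ • cond μ (τ ⁻¹' {i})) =
      ENNReal.ofReal (w i j) • cond μ (τ ⁻¹' {i}) := by
    intro j
    by_cases hij : w i j = 0
    · simp [hij]
    · have := isProbabilityMeasure_cond_of_ne_zero (μ := ν) (w := fun j i => w i j)
        (fun j i => hw i j) hcol hij
      simp
  rw [Finset.sum_congr rfl fun j _ => hterm j, ← Finset.sum_smul,
    ← ENNReal.ofReal_sum_of_nonneg fun j _ => hw i j, hrow i, ofReal_measureReal]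

lemma glue_map_snd [IsFiniteMeasure μ] [IsFiniteMeasure ν] (hτ : Measurable τ)
    (hw : ∀ i j, 0 ≤ w i j) (hrow : ∀ i, ∑ j, w i j = μ.real (τ ⁻¹' {i}))
    (hcol : ∀ j, ∑ i, w i j = ν.real (τ ⁻¹' {j})) :
    (glue μ ν τ w).map Prod.snd = ν := by
  have h := glue_map_fst (μ := ν) (ν := μ) hτ (fun j i => hw i j) hcol hrow
  rwa [← glue_map_swap, Measure.map_map measurable_fst measurable_swap] at h

lemma integral_glue [IsFiniteMeasure μ] [IsFiniteMeasure ν] (hτ : Measurable τ)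
    (hw : ∀ i j, 0 ≤ w i j) (hrow : ∀ i, ∑ j, w i j = μ.real (τ ⁻¹' {i}))
    (hcol : ∀ j, ∑ i, w i j = ν.real (τ ⁻¹' {j})) (H : ι → ι → ℝ) :
    Integrable (fun p => H (τ p.1) (τ p.2)) (glue μ ν τ w) ∧
      ∫ p, H (τ p.1) (τ p.2) ∂glue μ ν τ w = ∑ i, ∑ j, w i j * H i j := by
  have hae : ∀ i j, (fun p : E × E => H (τ p.1) (τ p.2)) =ᵐ[ENNReal.ofReal (w i j) •
      (cond μ (τ ⁻¹' {i})).prod (cond ν (τ ⁻¹' {j}))] fun _ => H i j := by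
    intro i j
    refine Measure.ae_smul_measure ?_ _
    have h₁ := (Measure.quasiMeasurePreserving_fst (ν := cond ν (τ ⁻¹' {j}))).ae
      (ae_cond_mem (μ := μ) (hτ (.singleton i)))
    have h₂ := (Measure.quasiMeasurePreserving_snd (μ := cond μ (τ ⁻¹' {i}))).ae
      (ae_cond_mem (μ := ν) (hτ (.singleton j)))
    filter_upwards [h₁, h₂] with p hp₁ hp₂
    rw [show τ p.1 = i from hp₁, show τ p.2 = j from hp₂]
  have hint : ∀ i j, Integrable (fun p : E × E => H (τ p.1) (τ p.2)) (ENNReal.ofReal (w i j) •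
      (cond μ (τ ⁻¹' {i})).prod (cond ν (τ ⁻¹' {j}))) := fun i j =>
    ((integrable_const (H i j)).smul_measure ENNReal.ofReal_ne_top).congr (hae i j).symm
  refine ⟨integrable_finsetSum_measure.2 fun i _ => integrable_finsetSum_measure.2 fun j _ =>
    hint i j, ?_⟩
  rw [glue, integral_finsetSum_measure fun i _ =>
    integrable_finsetSum_measure.2 fun j _ => hint i j]
  refine Finset.sum_congr rfl fun i _ => ?_
  rw [integral_finsetSum_measure fun j _ => hint i j]
  refine Finset.sum_congr rfl fun j _ => ?_
  rw [integral_congr_ae (hae i j), integral_smul_measure, ENNReal.toReal_ofReal (hw i j)]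
  by_cases hij : w i j = 0
  · simp [hij]
  · have := isProbabilityMeasure_cond_of_ne_zero hw hrow hij
    have := isProbabilityMeasure_cond_of_ne_zero (μ := ν) (w := fun j i => w i j)
      (fun j i => hw i j) hcol hij
    simp

end Coupling

section Duality

variable {E : Type*} [NormedAddCommGroup E] [MeasurableSpace E]

/-- The values `∫ f dμ - ∫ f dν` over 1-Lipschitz functions `f`. -/
def kantorovichValues (μ ν : Measure E) : Set ℝ :=
  {r | ∃ f : E → ℝ, LipschitzWith 1 f ∧ r = ∫ x, f x ∂μ - ∫ x, f x ∂ν}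

variable [BorelSpace E] [SecondCountableTopology E] {μ ν : Measure E}

lemma FiniteFirstMoment.integrable_id (h : FiniteFirstMoment μ) :
    Integrable (fun x : E => x) μ :=
  ⟨measurable_id.aestronglyMeasurable, by
    simpa [FiniteFirstMoment, HasFiniteIntegral] using h⟩

lemma FiniteFirstMoment.integrable_lipschitz [IsFiniteMeasure μ] (h : FiniteFirstMoment μ)
    {f : E → ℝ} (hf : LipschitzWith 1 f) : Integrable f μ := by
  refine ((integrable_const ‖f 0‖).add h.integrable_id.norm).mono'
    hf.continuous.aestronglyMeasurable (.of_forall fun x => ?_)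
  have h₁ := hf.dist_le_mul x 0
  have h₂ := norm_sub_norm_le (f x) (f 0)
  rw [dist_eq_norm, dist_zero_right, NNReal.coe_one, one_mul] at h₁
  simp only [Pi.add_apply]
  linarith

/-- The set of transport costs whose infimum is the 1-Wasserstein distance. -/
def couplingCosts (μ ν : Measure E) : Set ℝ :=
  {c : ℝ | ∃ π : Measure (E × E), IsProbabilityMeasure π ∧
    π.map Prod.fst = μ ∧ π.map Prod.snd = ν ∧ c = ∫ p, ‖p.1 - p.2‖ ∂π}

lemma exists_simpleFunc_approx (hμ : FiniteFirstMoment μ) (hν : FiniteFirstMoment ν) {ε : ℝ}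
    (hε : 0 < ε) :
    ∃ T : SimpleFunc E E, ∫ x, ‖T x - x‖ ∂μ < ε ∧ ∫ x, ‖T x - x‖ ∂ν < ε := by
  have key : ∀ ρ : Measure E, FiniteFirstMoment ρ → ∀ᶠ n in Filter.atTop,
      ∫ x, ‖SimpleFunc.approxOn (fun x : E => x) measurable_id (range (fun x : E => x) ∪ {0}) 0
        (by simp) n x - x‖ ∂ρ < ε := by
    intro ρ hρ
    have h := SimpleFunc.tendsto_approxOn_range_L1_enorm (f := fun x : E => x) measurable_id hρ.integrable_id
    filter_upwards [h.eventually_lt_const (ENNReal.ofReal_pos.2 hε)] with n hn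
    rw [integral_norm_eq_lintegral_enorm
      (by exact ((SimpleFunc.measurable _).sub measurable_id).aestronglyMeasurable)]
    exact (ENNReal.lt_ofReal_iff_toReal_lt hn.ne_top).1 hn
  obtain ⟨n, h₁, h₂⟩ := ((key μ hμ).and (key ν hν)).exists
  exact ⟨_, h₁, h₂⟩

variable [IsProbabilityMeasure μ] [IsProbabilityMeasure ν]

lemma kantorovichValues_le_couplingCosts (hμ : FiniteFirstMoment μ) (hν : FiniteFirstMoment ν)
    {r c : ℝ} (hr : r ∈ kantorovichValues μ ν) (hc : c ∈ couplingCosts μ ν) : r ≤ c := by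
  obtain ⟨f, hf, rfl⟩ := hr
  obtain ⟨π, -, h₁, h₂, rfl⟩ := hc
  obtain ⟨hi₁, he₁⟩ := integral_comp_fst h₁ (hμ.integrable_lipschitz hf)
  obtain ⟨hi₂, he₂⟩ := integral_comp_snd h₂ (hν.integrable_lipschitz hf)
  have hid₁ : Integrable (fun p : E × E => p.1) π := by
    rw [← h₁] at hμ; exact hμ.integrable_id.comp_measurable measurable_fst
  have hid₂ : Integrable (fun p : E × E => p.2) π := by
    rw [← h₂] at hν; exact hν.integrable_id.comp_measurable measurable_snd
  rw [← he₁, ← he₂, ← integral_sub hi₁ hi₂]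
  refine integral_mono (hi₁.sub hi₂) (hid₁.sub hid₂).norm fun p => ?_
  have := hf.dist_le_mul p.1 p.2
  rw [NNReal.coe_one, one_mul, dist_eq_norm (p.1)] at this
  exact (le_abs_self _).trans this

lemma exists_coupling_of_transport_matrix (hμ : FiniteFirstMoment μ) (hν : FiniteFirstMoment ν)
    {ι : Type*} [Fintype ι] [MeasurableSpace ι] [DiscreteMeasurableSpace ι]
    {τ : E → ι} (hτ : Measurable τ) (a : ι → E) {w : ι → ι → ℝ}
    (hw : ∀ i j, 0 ≤ w i j) (hrow : ∀ i, ∑ j, w i j = μ.real (τ ⁻¹' {i}))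
    (hcol : ∀ j, ∑ i, w i j = ν.real (τ ⁻¹' {j})) :
    ∃ c ∈ couplingCosts μ ν, c ≤ ∫ x, ‖a (τ x) - x‖ ∂μ + ∑ i, ∑ j, w i j * dist (a i) (a j)
      + ∫ x, ‖a (τ x) - x‖ ∂ν := by
  have haτ : ∀ (ρ : Measure E) [IsProbabilityMeasure ρ], Integrable (fun x => a (τ x)) ρ := by
    intro ρ _
    refine Integrable.of_bound ((measurable_of_finite a).comp hτ).aestronglyMeasurable
      (∑ i, ‖a i‖) (.of_forall fun x => ?_)
    exact Finset.single_le_sum (f := fun i => ‖a i‖) (fun i _ => norm_nonneg _)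
      (Finset.mem_univ (τ x))
  have h₁ := glue_map_fst hτ hw hrow hcol
  have h₂ := glue_map_snd hτ hw hrow hcol
  have hprob : IsProbabilityMeasure (glue μ ν τ w) := by
    rw [← Measure.isProbabilityMeasure_map_iff measurable_fst.aemeasurable, h₁]
    infer_instance
  refine ⟨_, ⟨glue μ ν τ w, hprob, h₁, h₂, rfl⟩, ?_⟩
  obtain ⟨hi₁, he₁⟩ := integral_comp_fst h₁ ((haτ μ).sub hμ.integrable_id).norm
  obtain ⟨hi₂, he₂⟩ := integral_comp_snd h₂ ((haτ ν).sub hν.integrable_id).norm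
  obtain ⟨hi₃, he₃⟩ := integral_glue hτ hw hrow hcol fun i j => dist (a i) (a j)
  simp only [Pi.sub_apply] at hi₁ he₁ hi₂ he₂
  rw [← he₁, ← he₂, ← he₃, ← integral_add hi₁ hi₃]
  rw [← integral_add (by exact hi₁.add hi₃) hi₂]
  refine integral_mono_of_nonneg (.of_forall fun p => norm_nonneg _) ((hi₁.add hi₃).add hi₂)
    (.of_forall fun p => ?_)
  have h₃ := dist_triangle4 p.1 (a (τ p.1)) (a (τ p.2)) p.2
  rw [dist_comm p.1 (a _)] at h₃
  simpa only [dist_eq_norm, Pi.add_apply] using h₃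

lemma integral_lipschitz_approx {ρ : Measure E} [IsProbabilityMeasure ρ]
    (hρ : FiniteFirstMoment ρ) (T : SimpleFunc E E) {f : E → ℝ} (hf : LipschitzWith 1 f) :
    |∫ x, f (T x) ∂ρ - ∫ x, f x ∂ρ| ≤ ∫ x, ‖T x - x‖ ∂ρ := by
  have hT : Integrable T ρ := T.integrable_of_isFiniteMeasure
  have hfT : Integrable (fun x => f (T x)) ρ := (T.map f).integrable_of_isFiniteMeasure
  rw [← integral_sub hfT (hρ.integrable_lipschitz hf)]
  refine (abs_integral_le_integral_abs).trans (integral_mono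
    (hfT.sub (hρ.integrable_lipschitz hf)).abs (hT.sub hρ.integrable_id).norm fun x => ?_)
  simpa [dist_eq_norm] using hf.dist_le_mul (T x) x

/-- **Kantorovich–Rubinstein duality**, hard direction. -/
lemma exists_couplingCosts_lt (hμ : FiniteFirstMoment μ) (hν : FiniteFirstMoment ν) {C : ℝ}
    (hC : C ∈ upperBounds (kantorovichValues μ ν)) {ε : ℝ} (hε : 0 < ε) :
    ∃ c ∈ couplingCosts μ ν, c < C + ε := by
  obtain ⟨T, hTμ, hTν⟩ := exists_simpleFunc_approx hμ hν (ε := ε / 4) (by positivity)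
  set τ : E → T.range := fun x => ⟨T x, T.mem_range_self x⟩
  have hτ : Measurable τ := T.measurable.subtype_mk
  have hbound : ∀ F : E → ℝ, LipschitzWith 1 F →
      ∑ i : T.range, F i * μ.real (τ ⁻¹' {i}) - ∑ i : T.range, F i * ν.real (τ ⁻¹' {i})
        ≤ C + ε / 2 := by
    intro F hF
    rw [← integral_comp_finite μ hτ fun i => F i, ← integral_comp_finite ν hτ fun i => F i]
    have h₁ := (abs_le.1 (integral_lipschitz_approx hμ T hF)).2
    have h₂ := (abs_le.1 (integral_lipschitz_approx hν T hF)).1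
    have h₃ := hC ⟨F, hF, rfl⟩
    simp only [τ]
    linarith
  obtain ⟨w, hw, hrow, hcol, hcost⟩ := exists_transport_matrix
    (sum_measureReal_fiber μ hτ) (sum_measureReal_fiber ν hτ) hbound
  obtain ⟨c, hc, hle⟩ := exists_coupling_of_transport_matrix hμ hν hτ Subtype.val hw hrow hcol
  refine ⟨c, hc, ?_⟩
  simp only [τ] at hle
  linarith

/-- **Kantorovich–Rubinstein duality**. -/
lemma isLUB_W1 (hμ : FiniteFirstMoment μ) (hν : FiniteFirstMoment ν) :
    IsLUB (kantorovichValues μ ν) (W1 μ ν) := by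
  have hne : (couplingCosts μ ν).Nonempty :=
    ⟨_, μ.prod ν, inferInstance, by simp, by simp, rfl⟩
  have hbdd : BddBelow (couplingCosts μ ν) :=
    ⟨0, fun c ⟨π, _, _, _, hc⟩ => hc ▸ integral_nonneg fun p => norm_nonneg _⟩
  refine ⟨fun r hr => le_csInf hne fun c hc => kantorovichValues_le_couplingCosts hμ hν hr hc,
    fun C hC => le_of_forall_pos_le_add fun ε hε => ?_⟩
  obtain ⟨c, hc, hlt⟩ := exists_couplingCosts_lt hμ hν hC hε
  exact (csInf_le hbdd hc).trans hlt.le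

end Duality

section Marginals

variable {d : ℕ} {lam : Fin d → ℝ} {μ ν : Measure (EuclideanSpace ℝ (Fin d))}

lemma measurable_coord (j : Fin d) : Measurable fun x : EuclideanSpace ℝ (Fin d) => x j :=
  (EuclideanSpace.proj (𝕜 := ℝ) j).measurable

lemma FiniteFirstMoment.map_coord (h : FiniteFirstMoment μ) (j : Fin d) :
    FiniteFirstMoment (μ.map fun x => x j) := by
  have h₁ : Integrable (fun x : EuclideanSpace ℝ (Fin d) => x j) μ :=
    h.integrable_id.norm.mono' (measurable_coord j).aestronglyMeasurable
      (.of_forall fun x => PiLp.norm_apply_le x j)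
  exact ((integrable_map_measure (g := fun x : ℝ => ‖x‖) (by fun_prop)
    (measurable_coord j).aemeasurable).2 h₁.norm).2

lemma integral_Flam [IsProbabilityMeasure μ] (hμ : FiniteFirstMoment μ)
    {f : EuclideanSpace ℝ (Fin d) → ℝ} {g : Fin d → ℝ → ℝ} (hf : LipschitzWith 1 f)
    (hg : ∀ j, LipschitzWith 1 (g j)) :
    ∫ x, (f x + ∑ j, lam j * g j (x j)) ∂μ
      = ∫ x, f x ∂μ + ∑ j, lam j * ∫ t, g j t ∂(μ.map fun x => x j) := by
  have hint : ∀ j, Integrable (fun x : EuclideanSpace ℝ (Fin d) => lam j * g j (x j)) μ := by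
    intro j
    have := Measure.isProbabilityMeasure_map (μ := μ) (measurable_coord j).aemeasurable
    exact (((hμ.map_coord j).integrable_lipschitz (hg j)).comp_measurable
      (measurable_coord j)).const_mul _
  rw [integral_add (hμ.integrable_lipschitz hf) (integrable_finsetSum _ fun j _ => hint j),
    integral_finsetSum _ fun j _ => hint j]
  congr 1
  refine Finset.sum_congr rfl fun j _ => ?_
  rw [integral_const_mul, integral_map (measurable_coord j).aemeasurable
    (hg j).continuous.aestronglyMeasurable]

end Marginals

/-- Dual representation of the marginally-penalized Wasserstein
distance: `D(μ, μ') = sup_{φ ∈ F_λ} (∫ φ dμ - ∫ φ dμ')`. -/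
theorem mpw_dual_representation {d : ℕ} (lam : Fin d → ℝ) (hlam : ∀ j, 0 ≤ lam j)
    (μ μ' : Measure (EuclideanSpace ℝ (Fin d)))
    [IsProbabilityMeasure μ] [IsProbabilityMeasure μ']
    (hμ : FiniteFirstMoment μ) (hμ' : FiniteFirstMoment μ') :
    MPW lam μ μ' =
      sSup {r : ℝ | ∃ φ ∈ Flam lam, r = (∫ x, φ x ∂μ) - ∫ x, φ x ∂μ'} := by
  have hlub := isLUB_W1 hμ hμ'
  have hlubm : ∀ j, IsLUB (kantorovichValues (μ.map fun x => x j) (μ'.map fun x => x j))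
      (W1 (μ.map fun x => x j) (μ'.map fun x => x j)) := by
    intro j
    have := Measure.isProbabilityMeasure_map (μ := μ) (measurable_coord j).aemeasurable
    have := Measure.isProbabilityMeasure_map (μ := μ') (measurable_coord j).aemeasurable
    exact isLUB_W1 (hμ.map_coord j) (hμ'.map_coord j)
  have hvalue : ∀ {f : EuclideanSpace ℝ (Fin d) → ℝ} {g : Fin d → ℝ → ℝ}, LipschitzWith 1 f →
      (∀ j, LipschitzWith 1 (g j)) →
      ∫ x, (f x + ∑ j, lam j * g j (x j)) ∂μ - ∫ x, (f x + ∑ j, lam j * g j (x j)) ∂μ'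
        = (∫ x, f x ∂μ - ∫ x, f x ∂μ') + ∑ j, lam j *
          (∫ t, g j t ∂(μ.map fun x => x j) - ∫ t, g j t ∂(μ'.map fun x => x j)) := by
    intro f g hf hg
    rw [integral_Flam hμ hf hg, integral_Flam hμ' hf hg]
    simp only [mul_sub, Finset.sum_sub_distrib]
    ring
  have hne : {r : ℝ | ∃ φ ∈ Flam lam, r = (∫ x, φ x ∂μ) - ∫ x, φ x ∂μ'}.Nonempty :=
    ⟨_, _, ⟨fun _ => 0, fun _ _ => 0, .const' 0, fun _ => .const' 0, fun _ => rfl⟩, rfl⟩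
  refine (IsLUB.csSup_eq ⟨?_, fun C hC => ?_⟩ hne).symm
  · rintro _ ⟨φ, ⟨f, g, hf, hg, hφ⟩, rfl⟩
    simp only [hφ]
    rw [hvalue hf hg, MPW]
    gcongr with j
    · exact hlub.1 ⟨f, hf, rfl⟩
    · exact hlam j
    · exact (hlubm j).1 ⟨g j, hg j, rfl⟩
  · have happrox : ∀ ε > 0, MPW lam μ μ' - (1 + ∑ j, lam j) * ε ≤ C := by
      intro ε hε
      obtain ⟨_, ⟨f, hf, rfl⟩, hfε, -⟩ := hlub.exists_between (sub_lt_self _ hε)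
      have hex : ∀ j, ∃ g : ℝ → ℝ, LipschitzWith 1 g ∧
          W1 (μ.map fun x => x j) (μ'.map fun x => x j) - ε ≤
            ∫ t, g t ∂(μ.map fun x => x j) - ∫ t, g t ∂(μ'.map fun x => x j) := by
        intro j
        obtain ⟨_, ⟨g, hg, rfl⟩, hgε, -⟩ := (hlubm j).exists_between (sub_lt_self _ hε)
        exact ⟨g, hg, hgε.le⟩
      choose g hg hgε using hex
      have hmem := hC ⟨_, ⟨f, g, hf, hg, fun _ => rfl⟩, rfl⟩
      rw [hvalue hf hg] at hmem
      have hsum := Finset.sum_le_sum fun j (_ : j ∈ Finset.univ) =>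
        mul_le_mul_of_nonneg_left (hgε j) (hlam j)
      simp only [mul_sub (lam _) (W1 _ _) ε, Finset.sum_sub_distrib, ← Finset.sum_mul] at hsum
      rw [MPW]
      linarith
    have hpos : 0 < 1 + ∑ j, lam j :=
      add_pos_of_pos_of_nonneg one_pos (Finset.sum_nonneg fun j _ => hlam j)
    refine le_of_forall_pos_le_add fun δ hδ => ?_
    have := happrox (δ / (1 + ∑ j, lam j)) (div_pos hδ hpos)
    rw [mul_div_cancel₀ _ hpos.ne'] at this
    linarith
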